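/- (Newton's identity, symmetric form) For a q-super Manin matrix M, with S(t) = \sum_{k\ge 0} t^k str_{1,...,k}(\mathcal{H}_k^q M_1 \cdots M_k) and T(t) = \sum_{k\ge 0} t^k str(M^{[k+1]}), one has \partial_t S(t) = T(t) S(t). -/

import Mathlib

open scoped BigOperators Classical
open Finset

namespace QSM

/-- Parity of a basis index of `ℂ^{m|n}`: `0` (even) for indices `< m`, `1` (odd) otherwise. -/
def pa (m : ℕ) {N : ℕ} (i : Fin N) : ℕ := if (i : ℕ) < m then 0 else 1

/-- The sign `ε(i - j)`: `1` if `i > j`, `0` if `i = j`, `-1` if `i < j`. -/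
def eps {N : ℕ} (i j : Fin N) : ℤ :=
  if (j : ℕ) < (i : ℕ) then 1 else if (i : ℕ) < (j : ℕ) then -1 else 0

variable {B : Type*} [Ring B] [Algebra ℂ B]

/-- Map a complex matrix into a matrix over the `ℂ`-algebra `B`. -/
noncomputable def cmap {I : Type*} (X : Matrix I I ℂ) : Matrix I I B :=
  X.map (algebraMap ℂ B)

/-- The super tensor product `E_{ij} ⊗ E_{kl}` of matrix units, as an operator on the
graded tensor square of `ℂ^{m|n}` (super sign conventions). -/
noncomputable def stu (m : ℕ) {N : ℕ} (i j k l : Fin N) :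
    Matrix (Fin N × Fin N) (Fin N × Fin N) ℂ :=
  Matrix.of fun p r =>
    ((-1 : ℂ) ^ ((pa m k + pa m l) * pa m r.1)) *
      (if p.1 = i ∧ r.1 = j then 1 else 0) * (if p.2 = k ∧ r.2 = l then 1 else 0)

/-- The operator `P^q = ∑_{i,j} q^{ε(i-j)} (-1)^{\bar j} E_{ij} ⊗ E_{ji}` on
`(ℂ^{m|n})^{⊗2}`. -/
noncomputable def Pq (q : ℂ) (m : ℕ) {N : ℕ} : Matrix (Fin N × Fin N) (Fin N × Fin N) ℂ :=
  ∑ i : Fin N, ∑ j : Fin N, (q ^ eps i j * (-1 : ℂ) ^ pa m j) • stu m i j j i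

/-- `M₁ = ∑ (-1)^{\bar i\bar j+\bar j} M_{ij} ⊗ E_{ij} ⊗ 1` on the tensor square. -/
noncomputable def Mone (m : ℕ) {N : ℕ} (M : Matrix (Fin N) (Fin N) B) :
    Matrix (Fin N × Fin N) (Fin N × Fin N) B :=
  Matrix.of fun p r =>
    if p.2 = r.2 then
      ((-1 : ℂ) ^ (pa m p.1 * pa m r.1 + pa m r.1)) • M p.1 r.1
    else 0

/-- `M₂ = ∑ (-1)^{\bar i\bar j+\bar j} M_{ij} ⊗ 1 ⊗ E_{ij}` on the tensor square
(with the super sign of `1 ⊗ E_{ij}`). -/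
noncomputable def Mtwo (m : ℕ) {N : ℕ} (M : Matrix (Fin N) (Fin N) B) :
    Matrix (Fin N × Fin N) (Fin N × Fin N) B :=
  Matrix.of fun p r =>
    if p.1 = r.1 then
      ((-1 : ℂ) ^ (pa m p.2 * pa m r.2 + pa m r.2 + (pa m p.2 + pa m r.2) * pa m r.1)) •
        M p.2 r.2
    else 0

/-- The `q`-super Manin matrix condition in matrix form:
`(1 - P^q) M₁ M₂ (1 + P^q) = 0`. -/
def IsManin (q : ℂ) (m : ℕ) {N : ℕ} (M : Matrix (Fin N) (Fin N) B) : Prop :=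
  (1 - cmap (Pq q m)) * Mone m M * Mtwo m M * (1 + cmap (Pq q m)) = 0

/-- The entrywise relations of the right quantum superalgebra `𝓜_{m|n}`. -/
def ManinRel (q : ℂ) (m : ℕ) {N : ℕ} (M : Matrix (Fin N) (Fin N) B) : Prop :=
  (∀ i j, pa m i = 1 → pa m j = 0 → M i j * M i j = 0) ∧
  (∀ i k l, pa m i = 1 →
    M i k * M i l = (q ^ eps l k * (-1 : ℂ) ^ ((pa m k + 1) * (pa m l + 1))) • (M i l * M i k)) ∧
  (∀ i j k, pa m k = 0 →
    M i k * M j k = (q ^ eps i j * (-1 : ℂ) ^ (pa m i * pa m j)) • (M j k * M i k)) ∧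
  (∀ i j k l,
    M i j * M k l -
        (q ^ (eps i k + eps l j) * (-1 : ℂ) ^ ((pa m i + pa m j) * (pa m k + pa m l))) •
          (M k l * M i j)
      = (q ^ eps i k * (-1 : ℂ) ^ (pa m i * pa m k + pa m j * pa m k + pa m i * pa m j)) •
            (M k j * M i l)
        - (q ^ eps l j * (-1 : ℂ) ^ (pa m j * pa m k + pa m j * pa m l + pa m k * pa m l)) •
            (M i l * M k j))

/-- The operator `P^q_σ` on `(ℂ^{m|n})^{⊗k}` (defined via reduced decompositions of `σ`;
equivalently, by the explicit inversion formula used here). -/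
noncomputable def Pperm (q : ℂ) (m : ℕ) {N k : ℕ} (σ : Equiv.Perm (Fin k)) :
    Matrix (Fin k → Fin N) (Fin k → Fin N) ℂ :=
  Matrix.of fun f g =>
    if f = g ∘ ⇑σ⁻¹ then
      ∏ p ∈ Finset.univ.filter (fun p : Fin k × Fin k => p.1 < p.2 ∧ σ p.2 < σ p.1),
        (q ^ eps (g p.1) (g p.2) * (-1 : ℂ) ^ (pa m (g p.1) * pa m (g p.2)))
    else 0

/-- The `q`-antisymmetrizer over the tensor positions in `S`. -/
noncomputable def AqS (q : ℂ) (m : ℕ) {N k : ℕ} (S : Finset (Fin k)) :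
    Matrix (Fin k → Fin N) (Fin k → Fin N) ℂ :=
  (S.card.factorial : ℂ)⁻¹ •
    ∑ σ ∈ Finset.univ.filter (fun σ : Equiv.Perm (Fin k) => ∀ t ∉ S, σ t = t),
      (((Equiv.Perm.sign σ : ℤ) : ℂ)) • Pperm q m (N := N) σ

/-- The `q`-symmetrizer over the tensor positions in `S`. -/
noncomputable def HqS (q : ℂ) (m : ℕ) {N k : ℕ} (S : Finset (Fin k)) :
    Matrix (Fin k → Fin N) (Fin k → Fin N) ℂ :=
  (S.card.factorial : ℂ)⁻¹ •
    ∑ σ ∈ Finset.univ.filter (fun σ : Equiv.Perm (Fin k) => ∀ t ∉ S, σ t = t),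
      Pperm q m (N := N) σ

/-- `M_a`: the copy of `M` in the `a`-th slot of `B ⊗ End(ℂ^{m|n})^{⊗k}`, with the super
sign factors `(-1)^{\bar i\bar j+\bar j}` and the super signs of `1⊗⋯⊗E_{ij}⊗⋯⊗1`. -/
noncomputable def Mslot (m : ℕ) {N k : ℕ} (M : Matrix (Fin N) (Fin N) B) (a : Fin k) :
    Matrix (Fin k → Fin N) (Fin k → Fin N) B :=
  Matrix.of fun f g =>
    if ∀ b, b ≠ a → f b = g b then
      ((-1 : ℂ) ^ (pa m (f a) * pa m (g a) + pa m (g a)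
          + (pa m (f a) + pa m (g a)) *
              ∑ b ∈ Finset.univ.filter (fun b => b < a), pa m (g b))) •
        M (f a) (g a)
    else 0

/-- The product `M₁ M₂ ⋯ M_k`. -/
noncomputable def MProd (m : ℕ) {N : ℕ} (M : Matrix (Fin N) (Fin N) B) (k : ℕ) :
    Matrix (Fin k → Fin N) (Fin k → Fin N) B :=
  (List.ofFn fun a : Fin k => Mslot m M a).prod

/-- The `q`-super Manin condition in the form `𝒜₂^q M₁ M₂ ℋ₂^q = 0`. -/
def IsManin2 (q : ℂ) (m : ℕ) {N : ℕ} (M : Matrix (Fin N) (Fin N) B) : Prop :=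
  cmap (AqS q m (Finset.univ : Finset (Fin 2))) * Mslot m M (0 : Fin 2) *
      Mslot m M (1 : Fin 2) * cmap (HqS q m (Finset.univ : Finset (Fin 2))) = 0

/-- The supertrace `str_{1,…,k}` over all `k` tensor slots. -/
noncomputable def strAll (m : ℕ) {N k : ℕ}
    (X : Matrix (Fin k → Fin N) (Fin k → Fin N) B) : B :=
  ∑ f : Fin k → Fin N, ((-1 : ℂ) ^ (∑ t, pa m (f t))) • X f f

/-- The supertrace of an `N × N` matrix. -/
noncomputable def strM (m : ℕ) {N : ℕ} (X : Matrix (Fin N) (Fin N) B) : B :=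
  ∑ i, ((-1 : ℂ) ^ pa m i) • X i i

/-- The star product `B * C = str₁ (P^q_{12} B₁ C₂)`. -/
noncomputable def starMul (q : ℂ) (m : ℕ) {N : ℕ} (X Y : Matrix (Fin N) (Fin N) B) :
    Matrix (Fin N) (Fin N) B :=
  Matrix.of fun i j =>
    ((-1 : ℂ) ^ (pa m i * pa m j + pa m j)) •
      ∑ a : Fin N, ((-1 : ℂ) ^ (pa m a * (1 + pa m i + pa m j))) •
        ((cmap (Pperm q m (Equiv.swap (0 : Fin 2) 1)) * Mslot m X (0 : Fin 2) *
            Mslot m Y (1 : Fin 2) :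
          Matrix (Fin 2 → Fin N) (Fin 2 → Fin N) B) ![a, i] ![a, j])

/-- The powers `M^{[k]}` of `M` with respect to the star product. -/
noncomputable def Mpow (q : ℂ) (m : ℕ) {N : ℕ} (M : Matrix (Fin N) (Fin N) B) :
    ℕ → Matrix (Fin N) (Fin N) B
  | 0 => 1
  | 1 => M
  | (j + 2) => starMul q m (Mpow q m M (j + 1)) M

/-- Coefficient of `t^k` in `A(t) = ∑ (-t)^k str_{1,…,k}(𝒜_k^q M₁⋯M_k)`. -/
noncomputable def coefA (q : ℂ) (m : ℕ) {N : ℕ} (M : Matrix (Fin N) (Fin N) B) (k : ℕ) : B :=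
  ((-1 : ℂ) ^ k) •
    strAll m (cmap (AqS q m (Finset.univ : Finset (Fin k))) * MProd m M k)

/-- Coefficient of `t^k` in `S(t) = ∑ t^k str_{1,…,k}(ℋ_k^q M₁⋯M_k)`. -/
noncomputable def coefS (q : ℂ) (m : ℕ) {N : ℕ} (M : Matrix (Fin N) (Fin N) B) (k : ℕ) : B :=
  strAll m (cmap (HqS q m (Finset.univ : Finset (Fin k))) * MProd m M k)

/-- Coefficient of `t^k` in `T(t) = ∑ t^k str(M^{[k+1]})`. -/
noncomputable def coefT (q : ℂ) (m : ℕ) {N : ℕ} (M : Matrix (Fin N) (Fin N) B) (k : ℕ) : B :=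
  strM m (Mpow q m M (k + 1))

/-- Coefficients `M^{i_1…i_k}_{j_1…j_k}` of `𝒜_k^q M₁⋯M_k` in the basis
`E_{i_1j_1} ⊗ ⋯ ⊗ E_{i_kj_k}` (super sign conventions). -/
noncomputable def MIJ (q : ℂ) (m : ℕ) {N k : ℕ} (M : Matrix (Fin N) (Fin N) B)
    (f g : Fin k → Fin N) : B :=
  ((-1 : ℂ) ^ (∑ a : Fin k, (pa m (f a) + pa m (g a)) *
      ∑ b ∈ Finset.univ.filter (fun b => b < a), pa m (g b))) •
    ((cmap (AqS q m (Finset.univ : Finset (Fin k))) * MProd m M k :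
      Matrix (Fin k → Fin N) (Fin k → Fin N) B) f g)

/-- Number of inversions (the length `l(σ)`) of a permutation. -/
def invCount {r : ℕ} (σ : Equiv.Perm (Fin r)) : ℕ :=
  (Finset.univ.filter fun p : Fin r × Fin r => p.1 < p.2 ∧ σ p.2 < σ p.1).card

/-- The quantum determinant `det_q(A) = ∑_σ (-q)^{-l(σ)} A_{σ(1),1} ⋯ A_{σ(r),r}`. -/
noncomputable def detq (q : ℂ) {r : ℕ} (A : Matrix (Fin r) (Fin r) B) : B :=
  ∑ σ : Equiv.Perm (Fin r),
    ((-q) ^ (-(invCount σ : ℤ))) • (List.ofFn fun i : Fin r => A (σ i) i).prod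

/-- The quantum Berezinian of a type `(r|s)` matrix `A` with (two-sided) inverse `Ainv`. -/
noncomputable def Ber (q : ℂ) (r s : ℕ) (A Ainv : Matrix (Fin (r + s)) (Fin (r + s)) B) : B :=
  (∑ σ : Equiv.Perm (Fin r), ((-q) ^ (-(invCount σ : ℤ))) •
      (List.ofFn fun i : Fin r => A (Fin.castAdd s (σ i)) (Fin.castAdd s i)).prod) *
  (∑ ρ : Equiv.Perm (Fin s), ((-q) ^ (-(invCount ρ : ℤ))) •
      (List.ofFn fun j : Fin s => Ainv (Fin.natAdd r j) (Fin.natAdd r (ρ j))).prod)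

/-- The `Π ∘ st` transform of a type `(r'|s')` matrix: a type `(s'|r')` matrix. -/
noncomputable def PiSt (r' s' : ℕ) (A : Matrix (Fin (r' + s')) (Fin (r' + s')) B) :
    Matrix (Fin (s' + r')) (Fin (s' + r')) B :=
  Matrix.of fun i j =>
    ((-1 : ℂ) ^ (pa s' i * (pa s' i + pa s' j))) •
      A (Fin.rev (Fin.cast (Nat.add_comm s' r') j)) (Fin.rev (Fin.cast (Nat.add_comm s' r') i))

/-- Left corner embedding `Fin a → Fin b`. -/
def embL (a b : ℕ) (h : a ≤ b) : Fin a → Fin b :=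
  fun i => ⟨(i : ℕ), lt_of_lt_of_le i.isLt h⟩

/-- Embedding of `Fin a` into `Fin b` shifted by `c`. -/
def embR (c a b : ℕ) (h : c + a ≤ b) : Fin a → Fin b :=
  fun i => ⟨c + (i : ℕ), by have := i.isLt; omega⟩

/-- `P^q ⊗ 1` on the triple tensor space. -/
noncomputable def P12 (q : ℂ) (m : ℕ) {N : ℕ} :
    Matrix (Fin N × Fin N × Fin N) (Fin N × Fin N × Fin N) ℂ :=
  Matrix.of fun p r =>
    Pq q m (p.1, p.2.1) (r.1, r.2.1) * (if p.2.2 = r.2.2 then 1 else 0)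

/-- `1 ⊗ P^q` on the triple tensor space (no extra super sign: `P^q` is even). -/
noncomputable def P23 (q : ℂ) (m : ℕ) {N : ℕ} :
    Matrix (Fin N × Fin N × Fin N) (Fin N × Fin N × Fin N) ℂ :=
  Matrix.of fun p r =>
    (if p.1 = r.1 then 1 else 0) * Pq q m (p.2.1, p.2.2) (r.2.1, r.2.2)

/-- The scalar picked up by `P^q` when basis vectors of indices `i` and `j` are interchanged. -/
noncomputable def crossFactor (q : ℂ) (m : ℕ) {N : ℕ} (i j : Fin N) : ℂ :=
  q ^ eps i j * (-1 : ℂ) ^ (pa m i * pa m j)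

lemma crossFactor_mul_comm_eq_one {q : ℂ} (hq : q ≠ 0) (m : ℕ) {N : ℕ} (i j : Fin N) :
    crossFactor q m i j * crossFactor q m j i = 1 := by
  have h : eps i j + eps j i = 0 := by
    unfold eps; split_ifs <;> omega
  have h2 : (-1 : ℂ) ^ (pa m i * pa m j) * (-1 : ℂ) ^ (pa m j * pa m i) = 1 := by
    rw [mul_comm (pa m j), ← mul_pow]; simp
  unfold crossFactor
  calc _ = (q ^ eps i j * q ^ eps j i) *
        ((-1 : ℂ) ^ (pa m i * pa m j) * (-1 : ℂ) ^ (pa m j * pa m i)) := by ring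
    _ = 1 := by rw [← zpow_add₀ hq, h, h2]; simp

lemma crossFactor_ne_zero {q : ℂ} (hq : q ≠ 0) (m : ℕ) {N : ℕ} (i j : Fin N) :
    crossFactor q m i j ≠ 0 :=
  left_ne_zero_of_mul_eq_one (crossFactor_mul_comm_eq_one hq m i j)

/-- The scalar by which `P^q_σ` acts on the basis word `g`. -/
noncomputable def permWeight (q : ℂ) (m : ℕ) {N k : ℕ} (σ : Equiv.Perm (Fin k))
    (g : Fin k → Fin N) : ℂ :=
  ∏ p : Fin k × Fin k,
    if p.1 < p.2 ∧ σ p.2 < σ p.1 then crossFactor q m (g p.1) (g p.2) else 1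

lemma Pperm_apply (q : ℂ) (m : ℕ) {N k : ℕ} (σ : Equiv.Perm (Fin k)) (f g : Fin k → Fin N) :
    Pperm q m σ f g = if f = g ∘ ⇑σ⁻¹ then permWeight q m σ g else 0 := by
  simp only [Pperm, Matrix.of_apply, permWeight, Finset.prod_filter, crossFactor]

lemma permWeight_mul {q : ℂ} (hq : q ≠ 0) (m : ℕ) {N k : ℕ} (σ τ : Equiv.Perm (Fin k))
    (g : Fin k → Fin N) :
    permWeight q m (σ * τ) g = permWeight q m σ (g ∘ ⇑τ⁻¹) * permWeight q m τ g := by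
  have hσ : permWeight q m σ (g ∘ ⇑τ⁻¹) = ∏ p : Fin k × Fin k,
      if τ p.1 < τ p.2 ∧ σ (τ p.2) < σ (τ p.1) then
        crossFactor q m (g p.1) (g p.2) else 1 := by
    unfold permWeight
    rw [← Equiv.prod_comp (Equiv.prodCongr τ τ)]
    simp
  have hne : permWeight q m (σ * τ) g ≠ 0 := by
    refine Finset.prod_ne_zero_iff.mpr fun p _ => ?_
    split_ifs
    · exact crossFactor_ne_zero hq m _ _
    · exact one_ne_zero
  have hinv := crossFactor_mul_comm_eq_one (N := N) hq m
  have hnz := crossFactor_ne_zero (N := N) hq m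
  symm
  rw [← div_eq_one_iff_eq hne, hσ]
  simp only [permWeight, ← Finset.prod_mul_distrib, ← Finset.prod_div_distrib]
  have key : ∀ i j : Fin k,
      ((if τ i < τ j ∧ σ (τ j) < σ (τ i) then crossFactor q m (g i) (g j) else 1) *
        (if i < j ∧ τ j < τ i then crossFactor q m (g i) (g j) else 1) /
        (if i < j ∧ σ (τ j) < σ (τ i) then crossFactor q m (g i) (g j) else 1)) *
      ((if τ j < τ i ∧ σ (τ i) < σ (τ j) then crossFactor q m (g j) (g i) else 1) *
        (if j < i ∧ τ i < τ j then crossFactor q m (g j) (g i) else 1) /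
        (if j < i ∧ σ (τ i) < σ (τ j) then crossFactor q m (g j) (g i) else 1)) = 1 := by
    intro i j
    have h1 := hinv (g i) (g j)
    have h2 := hnz (g i) (g j)
    have h3 := hnz (g j) (g i)
    rcases eq_or_ne i j with rfl | hij
    · simp
    have hτ : τ i ≠ τ j := fun h => hij (τ.injective h)
    have hστ : σ (τ i) ≠ σ (τ j) := fun h => hτ (σ.injective h)
    generalize crossFactor q m (g i) (g j) = x at *
    generalize crossFactor q m (g j) (g i) = y at *
    rcases lt_or_gt_of_ne hij with a | a <;> rcases lt_or_gt_of_ne hτ with b | b <;>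
      rcases lt_or_gt_of_ne hστ with c | c <;>
      simp [a, b, c, a.not_gt, b.not_gt, c.not_gt, h1, h2, h3]
  refine Finset.prod_involution (fun p _ => p.swap) (fun p _ => key p.1 p.2) ?_
    (fun _ _ => Finset.mem_univ _) (fun p _ => Prod.swap_swap p)
  rintro ⟨i, j⟩ _ h heq
  obtain rfl : j = i := congrArg Prod.fst heq
  exact h (by simp)

lemma permWeight_swap (q : ℂ) (m : ℕ) {N k : ℕ} (a b : Fin k) (hab : (b : ℕ) = a + 1)
    (g : Fin k → Fin N) :
    permWeight q m (Equiv.swap a b) g = crossFactor q m (g a) (g b) := by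
  unfold permWeight
  rw [Finset.prod_eq_single (a, b)]
  · rw [if_pos]
    simp only [Equiv.swap_apply_left, Equiv.swap_apply_right, Fin.lt_def]
    omega
  · rintro ⟨i, j⟩ _ hne
    rw [if_neg]
    rintro ⟨h1, h2⟩
    simp only [Prod.mk.injEq, not_and, Fin.ext_iff, ne_eq] at hne
    rw [Equiv.swap_apply_def, Equiv.swap_apply_def] at h2
    simp only [Fin.lt_def, Fin.ext_iff] at h1 h2
    split_ifs at h2 <;> omega
  · simp

/-- The permutation of `Fin (r + l)` acting by `τ` on the first `r` and by `σ` on the last `l`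
positions. -/
def blockPerm {r l : ℕ} (τ : Equiv.Perm (Fin r)) (σ : Equiv.Perm (Fin l)) :
    Equiv.Perm (Fin (r + l)) :=
  finSumFinEquiv.permCongr (Equiv.Perm.sumCongr τ σ)

@[simp] lemma blockPerm_castAdd {r l : ℕ} (τ : Equiv.Perm (Fin r)) (σ : Equiv.Perm (Fin l))
    (i : Fin r) : blockPerm τ σ (Fin.castAdd l i) = Fin.castAdd l (τ i) := by
  simp [blockPerm, Equiv.permCongr_apply]

@[simp] lemma blockPerm_natAdd {r l : ℕ} (τ : Equiv.Perm (Fin r)) (σ : Equiv.Perm (Fin l))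
    (i : Fin l) : blockPerm τ σ (Fin.natAdd r i) = Fin.natAdd r (σ i) := by
  simp [blockPerm, Equiv.permCongr_apply]

lemma blockPerm_mul {r l : ℕ} (τ τ' : Equiv.Perm (Fin r)) (σ σ' : Equiv.Perm (Fin l)) :
    blockPerm τ σ * blockPerm τ' σ' = blockPerm (τ * τ') (σ * σ') := by
  ext i
  refine Fin.addCases (fun i => ?_) (fun i => ?_) i <;> simp

lemma blockPerm_inv {r l : ℕ} (τ : Equiv.Perm (Fin r)) (σ : Equiv.Perm (Fin l)) :
    (blockPerm τ σ)⁻¹ = blockPerm τ⁻¹ σ⁻¹ := by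
  rw [inv_eq_iff_mul_eq_one, blockPerm_mul]
  ext i
  refine Fin.addCases (fun i => ?_) (fun i => ?_) i <;> simp

lemma permWeight_blockPerm (q : ℂ) (m : ℕ) {N r l : ℕ} (τ : Equiv.Perm (Fin r))
    (σ : Equiv.Perm (Fin l)) (g : Fin r → Fin N) (g' : Fin l → Fin N) :
    permWeight q m (blockPerm τ σ) (Fin.append g g') =
      permWeight q m τ g * permWeight q m σ g' := by
  have h1 : ∀ (i : Fin r) (j : Fin l), ¬ Fin.natAdd r j < Fin.castAdd l i := by
    intro i j h
    simp only [Fin.lt_def, Fin.val_natAdd, Fin.val_castAdd] at h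
    omega
  simp only [permWeight, Fintype.prod_prod_type, Fin.prod_univ_add, blockPerm_castAdd,
    blockPerm_natAdd, Fin.append_left, Fin.append_right, h1, false_and, and_false, if_false,
    Finset.prod_const_one, mul_one, one_mul]
  have h2 : ∀ i j : Fin r, Fin.castAdd l i < Fin.castAdd l j ↔ i < j := fun _ _ => Iff.rfl
  simp only [Fin.natAdd_lt_natAdd_iff, h2]

/-- The number of odd letters of a word. -/
def oddCount (m : ℕ) {N k : ℕ} (g : Fin k → Fin N) : ℕ := ∑ t, pa m (g t)

/-- The `(f, g)` entry of `M₁ ⋯ M_k`. -/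
noncomputable def wordEntry (m : ℕ) {N : ℕ} (M : Matrix (Fin N) (Fin N) B) :
    ∀ k : ℕ, (Fin k → Fin N) → (Fin k → Fin N) → B
  | 0, _, _ => 1
  | k + 1, f, g =>
    wordEntry m M k (fun i => f i.castSucc) (fun i => g i.castSucc) *
      ((-1 : ℂ) ^ (pa m (f (Fin.last k)) * pa m (g (Fin.last k)) + pa m (g (Fin.last k)) +
        (pa m (f (Fin.last k)) + pa m (g (Fin.last k))) *
          oddCount m (fun i => g i.castSucc))) • M (f (Fin.last k)) (g (Fin.last k))

/-- The operator `Y ⊗ 1` with one extra tensor slot on the right. -/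
def extendRight {C : Type*} [Semiring C] {N k : ℕ} (Y : Matrix (Fin k → Fin N) (Fin k → Fin N) C) :
    Matrix (Fin (k + 1) → Fin N) (Fin (k + 1) → Fin N) C :=
  Matrix.of fun f g =>
    if f (Fin.last k) = g (Fin.last k) then
      Y (fun i => f i.castSucc) (fun i => g i.castSucc) else 0

lemma sum_snoc {N k : ℕ} {C : Type*} [AddCommMonoid C] (F : (Fin (k + 1) → Fin N) → C) :
    ∑ f, F f = ∑ i : Fin N, ∑ f : Fin k → Fin N, F (Fin.snoc f i) := by
  rw [← Fintype.sum_prod_type', ← Equiv.sum_comp (Fin.snocEquiv fun _ => Fin N)]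
  rfl

lemma extendRight_one {C : Type*} [Semiring C] {N k : ℕ} :
    extendRight (1 : Matrix (Fin k → Fin N) (Fin k → Fin N) C) = 1 := by
  ext f g
  simp only [extendRight, Matrix.of_apply, Matrix.one_apply]
  by_cases h : f = g
  · simp [h]
  · rw [if_neg h]
    split_ifs with h1 h2
    · exact absurd (funext fun i => Fin.lastCases h1 (fun j => congrFun h2 j) i) h
    all_goals rfl

lemma extendRight_mul {C : Type*} [Semiring C] {N k : ℕ}
    (Y Z : Matrix (Fin k → Fin N) (Fin k → Fin N) C) :
    extendRight (Y * Z) = extendRight Y * extendRight Z := by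
  ext f g
  simp only [extendRight, Matrix.of_apply, Matrix.mul_apply, sum_snoc, Fin.snoc_last,
    Fin.snoc_castSucc]
  rw [Finset.sum_eq_single (f (Fin.last k))]
  · by_cases h : f (Fin.last k) = g (Fin.last k) <;> simp [h]
  · intro b _ hb
    simp [Ne.symm hb]
  · simp

lemma extendRight_list_prod {C : Type*} [Semiring C] {N k : ℕ}
    (L : List (Matrix (Fin k → Fin N) (Fin k → Fin N) C)) :
    extendRight L.prod = (L.map extendRight).prod := by
  induction L with
  | nil => exact extendRight_one
  | cons a L ih => rw [List.prod_cons, extendRight_mul, ih, List.map_cons, List.prod_cons]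

lemma sum_filter_lt_castSucc {k : ℕ} (F : Fin (k + 1) → ℕ) (a : Fin k) :
    ∑ b ∈ Finset.univ.filter (fun b => b < a.castSucc), F b =
      ∑ b ∈ Finset.univ.filter (fun b => b < a), F b.castSucc := by
  rw [Finset.sum_filter, Finset.sum_filter, Fin.sum_univ_castSucc]
  simp [not_lt.mpr (Fin.le_last _)]

lemma Mslot_castSucc (m : ℕ) {N k : ℕ} (M : Matrix (Fin N) (Fin N) B) (a : Fin k) :
    Mslot m M a.castSucc = extendRight (Mslot m M a) := by
  ext f g
  simp only [Mslot, extendRight, Matrix.of_apply, Fin.forall_fin_succ',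
    sum_filter_lt_castSucc]
  have h : (Fin.last k) ≠ a.castSucc := (Fin.castSucc_lt_last a).ne'
  simp only [ne_eq, h, not_false_eq_true, true_imp_iff, Fin.castSucc_inj]
  split_ifs <;> simp_all

lemma MProd_succ (m : ℕ) {N : ℕ} (M : Matrix (Fin N) (Fin N) B) (k : ℕ) :
    MProd m M (k + 1) = extendRight (MProd m M k) * Mslot m M (Fin.last k) := by
  unfold MProd
  rw [List.ofFn_succ', List.concat_eq_append, List.prod_append, List.prod_singleton,
    extendRight_list_prod, List.map_ofFn]
  simp only [Mslot_castSucc]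
  rfl

lemma extendRight_mul_Mslot_last_apply (m : ℕ) {N k : ℕ}
    (Y : Matrix (Fin k → Fin N) (Fin k → Fin N) B) (M : Matrix (Fin N) (Fin N) B)
    (f g : Fin (k + 1) → Fin N) :
    (extendRight Y * Mslot m M (Fin.last k)) f g =
      Y (fun i => f i.castSucc) (fun i => g i.castSucc) *
        ((-1 : ℂ) ^ (pa m (f (Fin.last k)) * pa m (g (Fin.last k)) + pa m (g (Fin.last k)) +
          (pa m (f (Fin.last k)) + pa m (g (Fin.last k))) *
            oddCount m (fun i => g i.castSucc))) • M (f (Fin.last k)) (g (Fin.last k)) := by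
  rw [Matrix.mul_apply, sum_snoc, Finset.sum_eq_single (f (Fin.last k)),
    Finset.sum_eq_single (fun i => g i.castSucc)]
  · have h : ∀ b : Fin (k + 1), b ≠ Fin.last k →
        (Fin.snoc (fun i => g i.castSucc) (f (Fin.last k)) : Fin (k + 1) → Fin N) b = g b := by
      intro b hb
      induction b using Fin.lastCases with
      | last => exact absurd rfl hb
      | cast b => simp
    simp only [extendRight, Mslot, Matrix.of_apply, Fin.snoc_last, if_true, Fin.snoc_castSucc,
      if_pos h, oddCount]
    rw [Finset.sum_filter, Fin.sum_univ_castSucc]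
    simp
  · intro h _ hne
    simp only [Mslot, Matrix.of_apply]
    rw [if_neg, mul_zero]
    intro hall
    refine hne (funext fun i => ?_)
    simpa using hall i.castSucc (Fin.castSucc_lt_last i).ne
  · simp
  · intro i _ hne
    refine Finset.sum_eq_zero fun h _ => ?_
    simp [extendRight, Ne.symm hne]
  · simp

lemma MProd_apply (m : ℕ) {N : ℕ} (M : Matrix (Fin N) (Fin N) B) (k : ℕ)
    (f g : Fin k → Fin N) : MProd m M k f g = wordEntry m M k f g := by
  induction k with
  | zero =>
    have : f = g := Subsingleton.elim _ _
    simp [MProd, wordEntry, this]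
  | succ k ih => rw [MProd_succ, extendRight_mul_Mslot_last_apply, ih, wordEntry]

lemma oddCount_add (m : ℕ) {N r l : ℕ} (g : Fin (r + l) → Fin N) :
    oddCount m g = oddCount m (fun i => g (Fin.castAdd l i)) +
      oddCount m (fun i => g (Fin.natAdd r i)) := by
  simp [oddCount, Fin.sum_univ_add]

lemma oddCount_comp_perm (m : ℕ) {N k : ℕ} (g : Fin k → Fin N) (σ : Equiv.Perm (Fin k)) :
    oddCount m (g ∘ ⇑σ) = oddCount m g :=
  Equiv.sum_comp σ fun t => pa m (g t)

lemma sign_append (a b i j c d : ℕ) :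
    (-1 : ℂ) ^ (i * j + j + (i + j) * (c + d)) * (-1 : ℂ) ^ ((a + b) * c) =
      (-1 : ℂ) ^ ((a + i + (b + j)) * c) * (-1 : ℂ) ^ (i * j + j + (i + j) * d) := by
  rw [← pow_add, ← pow_add]
  congr 1
  ring

lemma wordEntry_add (m : ℕ) {N : ℕ} (M : Matrix (Fin N) (Fin N) B) (r l : ℕ)
    (f g : Fin (r + l) → Fin N) :
    wordEntry m M (r + l) f g =
      ((-1 : ℂ) ^ ((oddCount m (fun i => f (Fin.natAdd r i)) +
          oddCount m (fun i => g (Fin.natAdd r i))) *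
          oddCount m (fun i => g (Fin.castAdd l i)))) •
        (wordEntry m M r (fun i => f (Fin.castAdd l i)) (fun i => g (Fin.castAdd l i)) *
          wordEntry m M l (fun i => f (Fin.natAdd r i)) (fun i => g (Fin.natAdd r i))) := by
  induction l with
  | zero => simp [wordEntry, oddCount]
  | succ l ih =>
    change wordEntry m M (r + l + 1) f g = _
    rw [wordEntry, ih, wordEntry]
    simp only [mul_smul_comm, smul_mul_assoc, smul_smul, ← mul_assoc]
    have hf : ∀ h : Fin (r + (l + 1)) → Fin N, oddCount m (fun i => h (Fin.natAdd r i)) =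
        oddCount m (fun i => h (Fin.natAdd r (Fin.castSucc i))) +
          pa m (h (Fin.last (r + l))) := fun h => Fin.sum_univ_castSucc _
    rw [hf f, hf g, oddCount_add]
    congr 1
    exact sign_append _ _ _ _ _ _

lemma cmap_Pperm_mul_apply (q : ℂ) (m : ℕ) {N k : ℕ} (σ : Equiv.Perm (Fin k))
    (Y : Matrix (Fin k → Fin N) (Fin k → Fin N) B) (f g : Fin k → Fin N) :
    ((cmap (Pperm q m σ) : Matrix (Fin k → Fin N) (Fin k → Fin N) B) * Y) f g =
      permWeight q m σ (f ∘ ⇑σ) • Y (f ∘ ⇑σ) g := by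
  rw [Matrix.mul_apply, Finset.sum_eq_single (f ∘ ⇑σ)]
  · have h : f = (f ∘ ⇑σ) ∘ ⇑σ⁻¹ := by ext; simp
    rw [cmap, Matrix.map_apply, Pperm_apply, if_pos h, Algebra.smul_def]
  · intro h _ hne
    rw [cmap, Matrix.map_apply, Pperm_apply, if_neg, map_zero, zero_mul]
    rintro rfl
    exact hne (by ext; simp)
  · simp

lemma mul_cmap_Pperm_apply (q : ℂ) (m : ℕ) {N k : ℕ} (σ : Equiv.Perm (Fin k))
    (Y : Matrix (Fin k → Fin N) (Fin k → Fin N) B) (f g : Fin k → Fin N) :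
    (Y * (cmap (Pperm q m σ) : Matrix (Fin k → Fin N) (Fin k → Fin N) B)) f g =
      permWeight q m σ g • Y f (g ∘ ⇑σ⁻¹) := by
  rw [Matrix.mul_apply, Finset.sum_eq_single (g ∘ ⇑σ⁻¹)]
  · rw [cmap, Matrix.map_apply, Pperm_apply, if_pos rfl, Algebra.smul_def, Algebra.commutes]
  · intro h _ hne
    rw [cmap, Matrix.map_apply, Pperm_apply, if_neg hne, map_zero, mul_zero]
  · simp

lemma cmap_smul {I : Type*} (c : ℂ) (X : Matrix I I ℂ) :
    (cmap (c • X) : Matrix I I B) = c • cmap X := by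
  ext i j
  simp [cmap, Algebra.smul_def]

lemma cmap_sum {I J : Type*} (s : Finset J) (X : J → Matrix I I ℂ) :
    (cmap (∑ j ∈ s, X j) : Matrix I I B) = ∑ j ∈ s, cmap (X j) := by
  ext i j
  simp [cmap, Matrix.sum_apply]

lemma Pperm_one (q : ℂ) (m : ℕ) {N k : ℕ} :
    Pperm q m (1 : Equiv.Perm (Fin k)) = (1 : Matrix (Fin k → Fin N) (Fin k → Fin N) ℂ) := by
  ext f g
  have h : permWeight q m (1 : Equiv.Perm (Fin k)) g = 1 :=
    Finset.prod_eq_one fun p _ => if_neg fun h => h.1.not_gt h.2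
  rw [Pperm_apply, h, Matrix.one_apply]
  rfl

lemma cmap_one {I : Type*} [DecidableEq I] : (cmap (1 : Matrix I I ℂ) : Matrix I I B) = 1 := by
  simp [cmap]

lemma cmap_add {I : Type*} (X Y : Matrix I I ℂ) :
    (cmap (X + Y) : Matrix I I B) = cmap X + cmap Y := by
  ext
  simp [cmap]

lemma cmap_sub {I : Type*} (X Y : Matrix I I ℂ) :
    (cmap (X - Y) : Matrix I I B) = cmap X - cmap Y := by
  ext
  simp [cmap]

lemma univ_perm_fin_two :
    (Finset.univ : Finset (Equiv.Perm (Fin 2))) = {1, Equiv.swap 0 1} := by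
  ext σ
  revert σ
  decide

lemma AqS_two (q : ℂ) (m : ℕ) {N : ℕ} :
    AqS q m (N := N) (Finset.univ : Finset (Fin 2)) =
      (2 : ℂ)⁻¹ • (1 - Pperm q m (Equiv.swap 0 1)) := by
  have h : (1 : Equiv.Perm (Fin 2)) ≠ Equiv.swap 0 1 := by decide
  simp only [AqS, Finset.mem_univ, not_true_eq_false, false_imp_iff, implies_true,
    Finset.filter_true, univ_perm_fin_two]
  rw [Finset.sum_pair h, Pperm_one, Equiv.Perm.sign_swap (by decide)]
  simp [sub_eq_add_neg]

lemma HqS_univ (q : ℂ) (m : ℕ) {N k : ℕ} :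
    HqS q m (N := N) (Finset.univ : Finset (Fin k)) =
      (k.factorial : ℂ)⁻¹ • ∑ σ : Equiv.Perm (Fin k), Pperm q m σ := by
  simp [HqS]

lemma HqS_two (q : ℂ) (m : ℕ) {N : ℕ} :
    HqS q m (N := N) (Finset.univ : Finset (Fin 2)) =
      (2 : ℂ)⁻¹ • (1 + Pperm q m (Equiv.swap 0 1)) := by
  have h : (1 : Equiv.Perm (Fin 2)) ≠ Equiv.swap 0 1 := by decide
  rw [HqS_univ, univ_perm_fin_two, Finset.sum_pair h, Pperm_one]
  simp

lemma IsManin2.exchange_two {q : ℂ} {m N : ℕ} {M : Matrix (Fin N) (Fin N) B}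
    (hM : IsManin2 q m M) (u v : Fin 2 → Fin N) :
    wordEntry m M 2 u v + crossFactor q m (v 0) (v 1) • wordEntry m M 2 u (v ∘ Equiv.swap 0 1) =
      crossFactor q m (u 1) (u 0) • wordEntry m M 2 (u ∘ Equiv.swap 0 1) v +
        (crossFactor q m (u 1) (u 0) * crossFactor q m (v 0) (v 1)) •
          wordEntry m M 2 (u ∘ Equiv.swap 0 1) (v ∘ Equiv.swap 0 1) := by
  have hP : Mslot m M (0 : Fin 2) * Mslot m M (1 : Fin 2) = MProd m M 2 := by
    simp [MProd, List.ofFn_succ]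
  have h := hM
  unfold IsManin2 at h
  rw [mul_assoc (cmap _), hP, AqS_two, HqS_two, cmap_smul, cmap_smul, smul_mul_assoc,
    smul_mul_assoc, mul_smul_comm, smul_smul,
    smul_eq_zero_iff_right (by norm_num : (2 : ℂ)⁻¹ * (2 : ℂ)⁻¹ ≠ 0)] at h
  have h' := congrFun (congrFun h u) v
  rw [cmap_sub, cmap_add, cmap_one, mul_add, mul_one, sub_mul, one_mul, sub_mul,
    Matrix.add_apply, Matrix.sub_apply, Matrix.sub_apply, mul_assoc, cmap_Pperm_mul_apply, cmap_Pperm_mul_apply,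
    mul_cmap_Pperm_apply, mul_cmap_Pperm_apply, permWeight_swap q m 0 1 rfl,
    permWeight_swap q m 0 1 rfl, Matrix.zero_apply] at h'
  simp only [MProd_apply, Equiv.swap_inv, Function.comp_apply, Equiv.swap_apply_left,
    Equiv.swap_apply_right, smul_smul] at h'
  rw [← sub_eq_zero, ← h']
  abel

lemma wordEntry_middle (m : ℕ) {N : ℕ} (M : Matrix (Fin N) (Fin N) B) (r l : ℕ)
    (f g : Fin (r + 2 + l) → Fin N) :
    wordEntry m M (r + 2 + l) f g =
      ((-1 : ℂ) ^ ((oddCount m (fun i => f (Fin.natAdd (r + 2) i)) +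
            oddCount m (fun i => g (Fin.natAdd (r + 2) i))) *
            (oddCount m (fun i => g (Fin.castAdd l (Fin.castAdd 2 i))) +
              oddCount m (fun i => g (Fin.castAdd l (Fin.natAdd r i)))) +
          (oddCount m (fun i => f (Fin.castAdd l (Fin.natAdd r i))) +
            oddCount m (fun i => g (Fin.castAdd l (Fin.natAdd r i)))) *
            oddCount m (fun i => g (Fin.castAdd l (Fin.castAdd 2 i))))) •
        (wordEntry m M r (fun i => f (Fin.castAdd l (Fin.castAdd 2 i)))
            (fun i => g (Fin.castAdd l (Fin.castAdd 2 i))) *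
          wordEntry m M 2 (fun i => f (Fin.castAdd l (Fin.natAdd r i)))
            (fun i => g (Fin.castAdd l (Fin.natAdd r i))) *
          wordEntry m M l (fun i => f (Fin.natAdd (r + 2) i))
            (fun i => g (Fin.natAdd (r + 2) i))) := by
  rw [wordEntry_add, wordEntry_add, oddCount_add m (fun i => g (Fin.castAdd l i)),
    smul_mul_assoc, smul_smul, ← pow_add]

lemma IsManin2.exchange {q : ℂ} {m N : ℕ} {M : Matrix (Fin N) (Fin N) B}
    (hM : IsManin2 q m M) {k : ℕ} (a b : Fin k) (hab : (b : ℕ) = a + 1)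
    (f g : Fin k → Fin N) :
    wordEntry m M k f g +
        crossFactor q m (g a) (g b) • wordEntry m M k f (g ∘ Equiv.swap a b) =
      crossFactor q m (f b) (f a) • wordEntry m M k (f ∘ Equiv.swap a b) g +
        (crossFactor q m (f b) (f a) * crossFactor q m (g a) (g b)) •
          wordEntry m M k (f ∘ Equiv.swap a b) (g ∘ Equiv.swap a b) := by
  obtain ⟨r, hr⟩ : ∃ r : ℕ, r = a := ⟨_, rfl⟩
  obtain ⟨l, rfl⟩ : ∃ l, k = r + 2 + l := ⟨k - (r + 2), by omega⟩
  obtain rfl : a = Fin.castAdd l (Fin.natAdd r 0) := Fin.ext (by simp [hr])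
  obtain rfl : b = Fin.castAdd l (Fin.natAdd r 1) := Fin.ext (by simp [hab])
  set s := Equiv.swap (Fin.castAdd l (Fin.natAdd r (0 : Fin 2)))
    (Fin.castAdd l (Fin.natAdd r (1 : Fin 2))) with hs
  have hleft : ∀ i : Fin r, s (Fin.castAdd l (Fin.castAdd 2 i)) =
      Fin.castAdd l (Fin.castAdd 2 i) := fun i =>
    Equiv.swap_apply_of_ne_of_ne (by simp [Fin.ext_iff]; omega) (by simp [Fin.ext_iff]; omega)
  have hright : ∀ i : Fin l, s (Fin.natAdd (r + 2) i) = Fin.natAdd (r + 2) i := fun i =>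
    Equiv.swap_apply_of_ne_of_ne (by simp [Fin.ext_iff]; omega) (by simp [Fin.ext_iff]; omega)
  have hmid : ∀ i : Fin 2, s (Fin.castAdd l (Fin.natAdd r i)) =
      Fin.castAdd l (Fin.natAdd r (Equiv.swap 0 1 i)) := by
    intro i
    fin_cases i <;> simp [hs]
  have hodd : ∀ h : Fin (r + 2 + l) → Fin N,
      oddCount m (fun i => h (Fin.castAdd l (Fin.natAdd r (Equiv.swap 0 1 i)))) =
        oddCount m (fun i => h (Fin.castAdd l (Fin.natAdd r i))) := fun h =>
    oddCount_comp_perm m (fun i => h (Fin.castAdd l (Fin.natAdd r i))) (Equiv.swap 0 1)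
  have key := hM.exchange_two (fun i => f (Fin.castAdd l (Fin.natAdd r i)))
    (fun i => g (Fin.castAdd l (Fin.natAdd r i)))
  simp only [Function.comp_def] at key
  simp only [wordEntry_middle, Function.comp_apply, hleft, hright, hmid, hodd]
  have hscaled := congrArg (fun x => wordEntry m M r
      (fun i => f (Fin.castAdd l (Fin.castAdd 2 i)))
      (fun i => g (Fin.castAdd l (Fin.castAdd 2 i))) * x *
    wordEntry m M l (fun i => f (Fin.natAdd (r + 2) i)) (fun i => g (Fin.natAdd (r + 2) i))) key
  simp only [mul_add, add_mul, mul_smul_comm, smul_mul_assoc] at hscaled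
  rw [smul_comm (crossFactor q m _ _), smul_comm (crossFactor q m _ _),
    smul_comm (crossFactor q m _ _ * _), ← smul_add, ← smul_add, hscaled]

/-- The supertrace `str_{1,…,k}(P^q_σ M₁ ⋯ M_k)`. -/
noncomputable def permTrace (q : ℂ) (m : ℕ) {N : ℕ} (M : Matrix (Fin N) (Fin N) B) {k : ℕ}
    (σ : Equiv.Perm (Fin k)) : B :=
  ∑ g : Fin k → Fin N,
    ((-1 : ℂ) ^ oddCount m g * permWeight q m σ g) • wordEntry m M k g (g ∘ ⇑σ⁻¹)

lemma strAll_cmap_Pperm_mul_MProd (q : ℂ) (m : ℕ) {N : ℕ} (M : Matrix (Fin N) (Fin N) B)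
    {k : ℕ} (σ : Equiv.Perm (Fin k)) :
    strAll m (cmap (Pperm q m σ) * MProd m M k) = permTrace q m M σ := by
  unfold strAll permTrace
  refine Fintype.sum_equiv (Equiv.arrowCongr σ.symm (Equiv.refl _)) _ _ fun f => ?_
  have hf : Equiv.arrowCongr σ.symm (Equiv.refl (Fin N)) f = f ∘ ⇑σ := rfl
  have hfσ : (f ∘ ⇑σ) ∘ ⇑σ⁻¹ = f := by ext; simp
  rw [cmap_Pperm_mul_apply, MProd_apply, hf, hfσ, oddCount_comp_perm, smul_smul]
  rfl

lemma coefS_eq_sum_permTrace (q : ℂ) (m : ℕ) {N : ℕ} (M : Matrix (Fin N) (Fin N) B) (k : ℕ) :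
    coefS q m M k = (k.factorial : ℂ)⁻¹ • ∑ σ : Equiv.Perm (Fin k), permTrace q m M σ := by
  have h : ∀ (J : Finset (Equiv.Perm (Fin k)))
      (Y : Equiv.Perm (Fin k) → Matrix (Fin k → Fin N) (Fin k → Fin N) B),
      strAll m (∑ σ ∈ J, Y σ) = ∑ σ ∈ J, strAll m (Y σ) := by
    intro J Y
    simp only [strAll, Matrix.sum_apply, Finset.smul_sum]
    exact Finset.sum_comm
  rw [coefS, HqS_univ, cmap_smul, smul_mul_assoc, cmap_sum, Finset.sum_mul]
  simp only [← strAll_cmap_Pperm_mul_MProd]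
  rw [← h]
  simp only [strAll, Finset.smul_sum, Matrix.smul_apply]
  exact Finset.sum_congr rfl fun _ _ => smul_comm _ _ _

lemma permTrace_mul_swap (q : ℂ) (hq : q ≠ 0) (m : ℕ) {N : ℕ} (M : Matrix (Fin N) (Fin N) B)
    {k : ℕ} (σ : Equiv.Perm (Fin k)) (a b : Fin k) (hab : (b : ℕ) = a + 1) (hM : IsManin2 q m M) :
    permTrace q m M σ + permTrace q m M (Equiv.swap a b * σ) =
      permTrace q m M (σ * Equiv.swap a b) +
        permTrace q m M (Equiv.swap a b * σ * Equiv.swap a b) := by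
  have hleft : ∀ τ : Equiv.Perm (Fin k), permTrace q m M (Equiv.swap a b * τ) =
      ∑ g : Fin k → Fin N, ((-1 : ℂ) ^ oddCount m g * permWeight q m τ g) •
        (crossFactor q m ((g ∘ ⇑τ⁻¹) a) ((g ∘ ⇑τ⁻¹) b) •
          wordEntry m M k g ((g ∘ ⇑τ⁻¹) ∘ Equiv.swap a b)) := by
    intro τ
    refine Finset.sum_congr rfl fun g _ => ?_
    rw [permWeight_mul hq, permWeight_swap q m a b hab, smul_smul, mul_inv_rev, Equiv.swap_inv,
      Equiv.Perm.coe_mul, ← Function.comp_assoc, mul_assoc, mul_comm (permWeight q m τ g)]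
  have hright : ∀ (c : (Fin k → Fin N) → ℂ)
      (F : (Fin k → Fin N) → (Fin k → Fin N)),
      ∑ g : Fin k → Fin N, ((-1 : ℂ) ^ oddCount m g * (permWeight q m σ g * c (g ∘ ⇑σ⁻¹))) •
        (crossFactor q m (g b) (g a) •
          wordEntry m M k (g ∘ Equiv.swap a b) (F (g ∘ ⇑σ⁻¹))) =
      ∑ g : Fin k → Fin N, ((-1 : ℂ) ^ oddCount m g *
          (permWeight q m (σ * Equiv.swap a b) g * c (g ∘ ⇑(σ * Equiv.swap a b)⁻¹))) •
        wordEntry m M k g (F (g ∘ ⇑(σ * Equiv.swap a b)⁻¹)) := by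
    intro c F
    refine Fintype.sum_equiv (Equiv.arrowCongr (Equiv.swap a b) (Equiv.refl _)) _ _ fun g => ?_
    have hg : Equiv.arrowCongr (Equiv.swap a b) (Equiv.refl (Fin N)) g = g ∘ Equiv.swap a b := by
      ext; simp [Equiv.arrowCongr]
    have h2 : (g ∘ Equiv.swap a b) ∘ ⇑(σ * Equiv.swap a b)⁻¹ = g ∘ ⇑σ⁻¹ := by
      ext; simp
    have h3 : (g ∘ Equiv.swap a b) ∘ ⇑(Equiv.swap a b)⁻¹ = g := by
      ext; simp
    rw [hg, h2, oddCount_comp_perm, permWeight_mul hq, h3, permWeight_swap q m a b hab, smul_smul]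
    simp only [Function.comp_apply, Equiv.swap_apply_left, Equiv.swap_apply_right]
    congr 1
    ring
  have h1 := hright (fun _ => 1) id
  have h2 := hright (fun h => crossFactor q m (h a) (h b)) (fun h => h ∘ Equiv.swap a b)
  simp only [mul_one, id] at h1
  rw [hleft, mul_assoc, hleft]
  change (∑ g, _) + _ = (∑ g, _) + _
  rw [← h1]
  simp only [smul_smul, mul_assoc] at h2 ⊢
  rw [← h2, ← Finset.sum_add_distrib, ← Finset.sum_add_distrib]
  refine Finset.sum_congr rfl fun g _ => ?_
  have key := congrArg (fun x => ((-1 : ℂ) ^ oddCount m g * permWeight q m σ g) • x)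
    (hM.exchange a b hab g (g ∘ ⇑σ⁻¹))
  simp only [smul_add, smul_smul, mul_assoc] at key
  rw [key, mul_comm (crossFactor q m (g b) (g a)) (crossFactor q m ((g ∘ ⇑σ⁻¹) a) _)]

lemma permTrace_blockPerm (q : ℂ) (m : ℕ) {N : ℕ} (M : Matrix (Fin N) (Fin N) B) {r l : ℕ}
    (τ : Equiv.Perm (Fin r)) (σ : Equiv.Perm (Fin l)) :
    permTrace q m M (blockPerm τ σ) = permTrace q m M τ * permTrace q m M σ := by
  unfold permTrace
  rw [Finset.sum_mul_sum, ← Fintype.sum_prod_type', ← Equiv.sum_comp (Fin.appendEquiv r l)]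
  refine Finset.sum_congr rfl fun p _ => ?_
  obtain ⟨g, g'⟩ := p
  change ((-1 : ℂ) ^ oddCount m (Fin.append g g') *
    permWeight q m (blockPerm τ σ) (Fin.append g g')) • wordEntry m M (r + l) (Fin.append g g')
      (Fin.append g g' ∘ ⇑(blockPerm τ σ)⁻¹) = _
  rw [wordEntry_add, oddCount_add, permWeight_blockPerm, smul_smul, smul_mul_smul_comm]
  simp only [Function.comp_apply, blockPerm_inv, blockPerm_castAdd, blockPerm_natAdd,
    Fin.append_left, Fin.append_right]
  have hodd : oddCount m (fun i => g' (σ⁻¹ i)) = oddCount m g' := oddCount_comp_perm m g' σ⁻¹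
  rw [hodd, ← two_mul, mul_assoc 2, pow_mul, neg_one_sq, one_pow, mul_one, pow_add]
  congr 1
  ring

lemma starMul_apply (q : ℂ) (m : ℕ) {N : ℕ} (X Y : Matrix (Fin N) (Fin N) B) (i j : Fin N) :
    starMul q m X Y i j = ((-1 : ℂ) ^ (pa m i * pa m j + pa m j)) •
      ∑ a : Fin N, ((-1 : ℂ) ^ (pa m a * (1 + pa m i + pa m j)) * crossFactor q m i a *
          (-1 : ℂ) ^ (pa m i * pa m a + pa m a) *
          (-1 : ℂ) ^ (pa m a * pa m j + pa m j + (pa m a + pa m j) * pa m a)) •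
        (X i a * Y a j) := by
  rw [starMul, Matrix.of_apply]
  congr 1
  refine Finset.sum_congr rfl fun a _ => ?_
  have h0 : Mslot m X (0 : Fin 2) = extendRight (Mslot m X (0 : Fin 1)) :=
    Mslot_castSucc m X (0 : Fin 1)
  have h1 : Mslot m Y (1 : Fin 2) = Mslot m Y (Fin.last 1) := rfl
  have hl : Fin.last 1 = (1 : Fin 2) := rfl
  have hX : ∀ f g : Fin 1 → Fin N, Mslot m X (0 : Fin 1) f g =
      ((-1 : ℂ) ^ (pa m (f 0) * pa m (g 0) + pa m (g 0))) • X (f 0) (g 0) := by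
    intro f g
    simp [Mslot, Fin.forall_fin_one]
  rw [mul_assoc (cmap _), h0, h1, cmap_Pperm_mul_apply, permWeight_swap q m 0 1 rfl,
    extendRight_mul_Mslot_last_apply, hX]
  simp only [oddCount, Function.comp_apply, Equiv.swap_apply_left, Equiv.swap_apply_right,
    Fin.castSucc_zero, hl, Finset.univ_unique, Finset.sum_singleton, Fin.default_eq_zero,
    Matrix.cons_val_zero, Matrix.cons_val_one, smul_mul_smul_comm, smul_smul, mul_assoc]

lemma Mpow_succ_apply (q : ℂ) (m : ℕ) {N : ℕ} (M : Matrix (Fin N) (Fin N) B) (r : ℕ)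
    (i j : Fin N) :
    Mpow q m M (r + 1) i j = ((-1 : ℂ) ^ (pa m i * pa m j + pa m j)) •
      ∑ f : Fin r → Fin N, ((-1 : ℂ) ^ (oddCount m f * (1 + pa m i + pa m j)) *
          ∏ b, crossFactor q m i (f b)) •
        wordEntry m M (r + 1) (Fin.cons i f) (Fin.snoc f j) := by
  induction r generalizing j with
  | zero =>
    have hM : wordEntry m M 1 (Fin.cons i default) (Fin.snoc default j) =
        ((-1 : ℂ) ^ (pa m i * pa m j + pa m j)) • M i j := by
      have h : (Fin.snoc default j : Fin 1 → Fin N) 0 = j := rfl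
      simp [wordEntry, h, oddCount]
    rw [Fintype.sum_unique, hM, smul_smul, smul_smul]
    have hs : (-1 : ℂ) ^ (pa m i * pa m j + pa m j) *
        (-1 : ℂ) ^ (pa m i * pa m j + pa m j) = 1 := by
      rw [← mul_pow]; simp
    simp [oddCount, hs, Mpow]
  | succ r ih =>
    rw [Mpow, starMul_apply, sum_snoc]
    congr 1
    refine Finset.sum_congr rfl fun a _ => ?_
    rw [ih, smul_mul_assoc, Finset.sum_mul, smul_smul, Finset.smul_sum]
    refine Finset.sum_congr rfl fun f _ => ?_
    have hw : wordEntry m M (r + 2) (Fin.cons i (Fin.snoc f a : Fin (r + 1) → Fin N))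
        (Fin.snoc (Fin.snoc f a : Fin (r + 1) → Fin N) j) =
        ((-1 : ℂ) ^ (pa m a * pa m j + pa m j + (pa m a + pa m j) * (oddCount m f + pa m a))) •
          (wordEntry m M (r + 1) (Fin.cons i f) (Fin.snoc f a) * M a j) := by
      rw [Fin.cons_snoc_eq_snoc_cons, wordEntry]
      simp only [Fin.snoc_last, Fin.snoc_castSucc]
      rw [mul_smul_comm]
      simp [oddCount, Fin.sum_univ_castSucc]
    have ho : oddCount m (Fin.snoc f a : Fin (r + 1) → Fin N) = oddCount m f + pa m a := by
      simp [oddCount, Fin.sum_univ_castSucc]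
    rw [hw, ho, Fin.prod_univ_castSucc, smul_mul_assoc, smul_smul, smul_smul]
    simp only [Fin.snoc_castSucc, Fin.snoc_last]
    congr 1
    have hsign : (-1 : ℂ) ^ (pa m a * (1 + pa m i + pa m j)) *
          (-1 : ℂ) ^ (pa m i * pa m a + pa m a) *
          (-1 : ℂ) ^ (pa m a * pa m j + pa m j + (pa m a + pa m j) * pa m a) *
          (-1 : ℂ) ^ (pa m i * pa m a + pa m a) *
          (-1 : ℂ) ^ (oddCount m f * (1 + pa m i + pa m a)) =
        (-1 : ℂ) ^ ((oddCount m f + pa m a) * (1 + pa m i + pa m j)) *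
          (-1 : ℂ) ^
            (pa m a * pa m j + pa m j + (pa m a + pa m j) * (oddCount m f + pa m a)) := by
      simp only [← pow_add]
      refine neg_one_pow_congr ?_
      simp only [Nat.even_add, Nat.even_mul]
      by_cases h1 : Even (pa m a) <;> by_cases h2 : Even (pa m i) <;>
        by_cases h3 : Even (pa m j) <;> by_cases h4 : Even (oddCount m f) <;>
        simp [h1, h2, h3, h4]
    generalize (-1 : ℂ) ^ (pa m a * (1 + pa m i + pa m j)) = x₁ at hsign ⊢
    generalize (-1 : ℂ) ^ (pa m i * pa m a + pa m a) = x₂ at hsign ⊢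
    generalize (-1 : ℂ) ^ (pa m a * pa m j + pa m j + (pa m a + pa m j) * pa m a) = x₃ at hsign ⊢
    generalize (-1 : ℂ) ^ (oddCount m f * (1 + pa m i + pa m a)) = x₄ at hsign ⊢
    generalize (-1 : ℂ) ^ ((oddCount m f + pa m a) * (1 + pa m i + pa m j)) = x₅ at hsign ⊢
    generalize (-1 : ℂ) ^
      (pa m a * pa m j + pa m j + (pa m a + pa m j) * (oddCount m f + pa m a)) = x₆ at hsign ⊢
    linear_combination (crossFactor q m i a * ∏ b, crossFactor q m i (f b)) * hsign

lemma finRotate_inv_zero (r : ℕ) : (finRotate (r + 1))⁻¹ 0 = Fin.last r := by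
  rw [Equiv.Perm.inv_eq_iff_eq, finRotate_last]

lemma finRotate_inv_succ {r : ℕ} (b : Fin r) : (finRotate (r + 1))⁻¹ b.succ = b.castSucc := by
  rw [Equiv.Perm.inv_eq_iff_eq]
  simp

lemma permWeight_finRotate_inv (q : ℂ) (m : ℕ) {N r : ℕ} (i : Fin N) (f : Fin r → Fin N) :
    permWeight q m (finRotate (r + 1))⁻¹ (Fin.cons i f) = ∏ b, crossFactor q m i (f b) := by
  unfold permWeight
  rw [Fintype.prod_prod_type, Fin.prod_univ_succ, Fin.prod_univ_succ]
  simp only [finRotate_inv_zero, finRotate_inv_succ, Fin.cons_zero, Fin.cons_succ,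
    Fin.prod_univ_succ, Fin.succ_lt_succ_iff,
    Fin.castSucc_lt_castSucc_iff, Fin.succ_pos, Fin.castSucc_lt_last, true_and, if_true, lt_irrefl,
    false_and, if_false, one_mul, Fin.not_lt_zero]
  have h : ∀ x y : Fin r, ¬ (x < y ∧ y < x) := fun x y h => h.1.not_gt h.2
  simp [h]

lemma coefT_eq_permTrace (q : ℂ) (m : ℕ) {N : ℕ} (M : Matrix (Fin N) (Fin N) B) (r : ℕ) :
    coefT q m M r = permTrace q m M (finRotate (r + 1))⁻¹ := by
  unfold coefT strM permTrace
  rw [← Equiv.sum_comp (Fin.consEquiv fun _ => Fin N), Fintype.sum_prod_type]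
  refine Finset.sum_congr rfl fun i _ => ?_
  rw [Mpow_succ_apply, smul_smul, Finset.smul_sum]
  refine Finset.sum_congr rfl fun f _ => ?_
  have hrot : (Fin.cons i f : Fin (r + 1) → Fin N) ∘ ⇑(finRotate (r + 1)) = Fin.snoc f i := by
    ext t
    refine Fin.lastCases ?_ (fun t => ?_) t
    · simp
    · rw [Function.comp_apply, Fin.snoc_castSucc, finRotate_of_lt (by simp)]
      rfl
  change _ = ((-1 : ℂ) ^ oddCount m (Fin.cons i f : Fin (r + 1) → Fin N) *
    permWeight q m (finRotate (r + 1))⁻¹ (Fin.cons i f)) • wordEntry m M (r + 1) (Fin.cons i f)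
      ((Fin.cons i f : Fin (r + 1) → Fin N) ∘ ⇑((finRotate (r + 1))⁻¹)⁻¹)
  rw [inv_inv, hrot, permWeight_finRotate_inv, smul_smul, ← mul_assoc, ← pow_add, ← pow_add]
  congr 2
  refine neg_one_pow_congr ?_
  have ho : oddCount m (Fin.cons i f : Fin (r + 1) → Fin N) = pa m i + oddCount m f := by
    simp [oddCount, Fin.sum_univ_succ]
  rw [ho]
  simp only [Nat.even_add, Nat.even_mul, Nat.not_even_one]
  by_cases h1 : Even (pa m i) <;> by_cases h2 : Even (oddCount m f) <;> simp [h1, h2]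

/-- The cycle `s_{r-1,r} ⋯ s_{1,2} s_{0,1}` on the first `r + 1` positions. -/
def initialCycle {k : ℕ} (r : ℕ) : Equiv.Perm (Fin k) :=
  match r with
  | 0 => 1
  | r + 1 => if h : r + 1 < k then
      Equiv.swap ⟨r, Nat.lt_of_succ_lt h⟩ ⟨r + 1, h⟩ * initialCycle r else 1

lemma initialCycle_apply_val {k : ℕ} (r : ℕ) (hr : r < k) (t : Fin k) :
    (initialCycle r t : ℕ) = if (t : ℕ) = 0 then r else if (t : ℕ) ≤ r then (t : ℕ) - 1 else t := by
  induction r with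
  | zero => simp only [initialCycle, Equiv.Perm.one_apply]; split_ifs <;> omega
  | succ r ih =>
    have ih := ih (by omega)
    rw [initialCycle, dif_pos hr, Equiv.Perm.mul_apply, Equiv.swap_apply_def]
    simp only [Fin.ext_iff, apply_ite Fin.val, ih]
    split_ifs <;> omega

lemma initialCycle_eq_blockPerm (r l : ℕ) :
    (initialCycle r : Equiv.Perm (Fin (r + 1 + l))) = blockPerm (finRotate (r + 1))⁻¹ 1 := by
  ext t
  rw [initialCycle_apply_val r (by omega)]
  refine Fin.addCases (fun u => ?_) (fun u => ?_) t
  · rw [blockPerm_castAdd]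
    refine Fin.cases ?_ (fun b => ?_) u
    · rw [finRotate_inv_zero]
      simp
    · rw [finRotate_inv_succ]
      simp only [Fin.val_castAdd, Fin.val_succ, Fin.val_castSucc]
      rw [if_neg (Nat.succ_ne_zero _), if_pos (Nat.succ_le_of_lt b.isLt), Nat.add_sub_cancel]
  · rw [blockPerm_natAdd, Equiv.Perm.one_apply]
    simp only [Fin.val_natAdd]
    split_ifs <;> omega

/-- The permutations of `Fin k` fixing every position before `r`. -/
noncomputable def tailPerms (k r : ℕ) : Finset (Equiv.Perm (Fin k)) :=
  Finset.univ.filter fun σ => ∀ t : Fin k, (t : ℕ) < r → σ t = t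

lemma mem_tailPerms {k r : ℕ} {σ : Equiv.Perm (Fin k)} :
    σ ∈ tailPerms k r ↔ ∀ t : Fin k, (t : ℕ) < r → σ t = t := by
  simp [tailPerms]

lemma sum_tailPerms_eq_sum_blockPerm {C : Type*} [AddCommMonoid C] (r l : ℕ)
    (F : Equiv.Perm (Fin (r + l)) → C) :
    ∑ σ ∈ tailPerms (r + l) r, F σ = ∑ σ : Equiv.Perm (Fin l), F (blockPerm 1 σ) := by
  symm
  refine Finset.sum_bij (fun σ _ => blockPerm 1 σ) ?_ ?_ ?_ (fun _ _ => rfl)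
  · intro σ _
    rw [mem_tailPerms]
    intro t ht
    have h : t = Fin.castAdd l ⟨t, ht⟩ := rfl
    rw [h, blockPerm_castAdd, Equiv.Perm.one_apply]
  · intro σ _ τ _ h
    ext i
    have := congrArg (fun e : Equiv.Perm (Fin (r + l)) => e (Fin.natAdd r i)) h
    simpa [Fin.ext_iff] using this
  · intro σ hσ
    rw [mem_tailPerms] at hσ
    have hmem : ∀ t : Fin (r + l), r ≤ (t : ℕ) → r ≤ (σ t : ℕ) := by
      intro t ht
      by_contra h
      have := σ.injective (hσ (σ t) (by omega))
      rw [this] at h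
      exact h ht
    have hmem' : ∀ t : Fin (r + l), r ≤ (t : ℕ) → r ≤ (σ.symm t : ℕ) := by
      intro t ht
      by_contra h
      have := hσ (σ.symm t) (by omega)
      rw [Equiv.apply_symm_apply] at this
      rw [← this] at h
      exact h ht
    refine ⟨⟨fun i => ⟨σ (Fin.natAdd r i) - r, by
        have := hmem (Fin.natAdd r i) (by simp); omega⟩,
      fun i => ⟨σ.symm (Fin.natAdd r i) - r, by
        have := hmem' (Fin.natAdd r i) (by simp); omega⟩, fun i => ?_, fun i => ?_⟩,
      Finset.mem_univ _, ?_⟩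
    · have h := hmem (Fin.natAdd r i) (by simp)
      have h' := (σ (Fin.natAdd r i)).isLt
      have h2 : Fin.natAdd r ⟨σ (Fin.natAdd r i) - r, by omega⟩ = σ (Fin.natAdd r i) :=
        Fin.ext (by simp; omega)
      apply Fin.ext
      simp [h2]
    · have h := hmem' (Fin.natAdd r i) (by simp)
      have h' := (σ.symm (Fin.natAdd r i)).isLt
      have h2 : Fin.natAdd r ⟨σ.symm (Fin.natAdd r i) - r, by omega⟩ = σ.symm (Fin.natAdd r i) :=
        Fin.ext (by simp; omega)
      apply Fin.ext
      simp only [h2]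
      simp
    · ext i
      refine Fin.addCases (fun i => ?_) (fun i => ?_) i
      · rw [hσ _ (by simp)]
        simp
      · have := hmem (Fin.natAdd r i) (by simp)
        simp only [blockPerm_natAdd, Equiv.coe_fn_mk, Fin.val_natAdd]
        omega

lemma sum_tailPerms_eq {C : Type*} [AddCommMonoid C] {k r : ℕ} (hr : r < k)
    (F : Equiv.Perm (Fin k) → C) :
    ∑ σ ∈ tailPerms k r, F σ =
      ∑ j ∈ Finset.univ.filter (fun j : Fin k => r ≤ (j : ℕ)),
        ∑ κ ∈ tailPerms k (r + 1), F (κ * Equiv.swap ⟨r, hr⟩ j) := by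
  rw [← Finset.sum_product']
  refine Finset.sum_bij' (fun σ _ => (σ.symm ⟨r, hr⟩, σ * Equiv.swap ⟨r, hr⟩ (σ.symm ⟨r, hr⟩)))
    (fun p _ => p.2 * Equiv.swap ⟨r, hr⟩ p.1) ?_ ?_ ?_ ?_ ?_
  · intro σ hσ
    rw [mem_tailPerms] at hσ
    have h1 : r ≤ (σ.symm ⟨r, hr⟩ : ℕ) := by
      by_contra h
      have := hσ (σ.symm ⟨r, hr⟩) (by omega)
      rw [Equiv.apply_symm_apply] at this
      rw [← this] at h
      exact h le_rfl
    simp only [Finset.mem_product, Finset.mem_filter, Finset.mem_univ, true_and, mem_tailPerms]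
    refine ⟨h1, fun t ht => ?_⟩
    rcases Nat.lt_succ_iff_lt_or_eq.mp ht with ht | ht
    · rw [Equiv.Perm.mul_apply, Equiv.swap_apply_of_ne_of_ne, hσ t ht]
      · rintro rfl; simp at ht
      · rintro rfl; omega
    · obtain rfl : t = ⟨r, hr⟩ := Fin.ext ht
      simp
  · rintro ⟨j, κ⟩ h
    simp only [Finset.mem_product, Finset.mem_filter, Finset.mem_univ, true_and,
      mem_tailPerms] at h ⊢
    intro t ht
    rw [Equiv.Perm.mul_apply, Equiv.swap_apply_of_ne_of_ne, h.2 t (by omega)]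
    · rintro rfl; simp at ht
    · rintro rfl; omega
  · intro σ _
    simp [mul_assoc]
  · rintro ⟨j, κ⟩ h
    simp only [Finset.mem_product, Finset.mem_filter, Finset.mem_univ, true_and,
      mem_tailPerms] at h
    have h2 : κ.symm ⟨r, hr⟩ = ⟨r, hr⟩ := by
      rw [Equiv.symm_apply_eq, h.2 _ (by simp)]
    have h3 : (κ * Equiv.swap ⟨r, hr⟩ j).symm ⟨r, hr⟩ = j := by
      rw [Equiv.symm_apply_eq, Equiv.Perm.mul_apply, Equiv.swap_apply_right, h.2 _ (by simp)]
    simp [h3, mul_assoc]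
  · intro σ _
    simp [mul_assoc]

lemma initialCycle_apply_of_lt {k r : ℕ} (hr : r < k) {t : Fin k} (ht : r < (t : ℕ)) :
    initialCycle r t = t := by
  apply Fin.ext
  rw [initialCycle_apply_val r hr]
  split_ifs <;> omega

lemma swap_mul_initialCycle_comm {k r : ℕ} (hr : r < k) {a b : Fin k} (ha : r < (a : ℕ))
    (hb : r < (b : ℕ)) :
    Equiv.swap a b * initialCycle r = initialCycle r * Equiv.swap a b := by
  have h := Equiv.mul_swap_eq_swap_mul (initialCycle r) a b
  rw [initialCycle_apply_of_lt hr ha, initialCycle_apply_of_lt hr hb] at h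
  exact h.symm

lemma sum_tailPerms_mul_left {C : Type*} [AddCommMonoid C] {k r : ℕ} {π : Equiv.Perm (Fin k)}
    (hπ : π ∈ tailPerms k r) (F : Equiv.Perm (Fin k) → C) :
    ∑ σ ∈ tailPerms k r, F (π * σ) = ∑ σ ∈ tailPerms k r, F σ := by
  have hmul : ∀ {σ}, π * σ ∈ tailPerms k r ↔ σ ∈ tailPerms k r := by
    intro σ
    rw [mem_tailPerms] at hπ
    simp only [mem_tailPerms, Equiv.Perm.mul_apply]
    refine forall₂_congr fun t ht => ⟨fun h => π.injective (h.trans (hπ t ht).symm), fun h => ?_⟩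
    rw [h, hπ t ht]
  exact Finset.sum_equiv (Equiv.mulLeft π) (fun σ => hmul.symm) fun σ _ => rfl

lemma sum_tailPerms_mul_right {C : Type*} [AddCommMonoid C] {k r : ℕ} {π : Equiv.Perm (Fin k)}
    (hπ : π ∈ tailPerms k r) (F : Equiv.Perm (Fin k) → C) :
    ∑ σ ∈ tailPerms k r, F (σ * π) = ∑ σ ∈ tailPerms k r, F σ := by
  have hmul : ∀ {σ}, σ * π ∈ tailPerms k r ↔ σ ∈ tailPerms k r := by
    intro σ
    rw [mem_tailPerms] at hπ
    simp only [mem_tailPerms, Equiv.Perm.mul_apply]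
    refine forall₂_congr fun t ht => ?_
    rw [hπ t ht]
  exact Finset.sum_equiv (Equiv.mulRight π) (fun σ => hmul.symm) fun σ _ => rfl

lemma swap_mem_tailPerms {k r : ℕ} {a b : Fin k} (ha : r ≤ (a : ℕ)) (hb : r ≤ (b : ℕ)) :
    Equiv.swap a b ∈ tailPerms k r := by
  rw [mem_tailPerms]
  intro t ht
  apply Equiv.swap_apply_of_ne_of_ne <;> rintro rfl <;> omega

section Manin

variable {q : ℂ} {m N : ℕ} {M : Matrix (Fin N) (Fin N) B}

lemma sum_tailPerms_permTrace_mul_swap (hq : q ≠ 0) (hM : IsManin2 q m M) {k r : ℕ}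
    (z : Equiv.Perm (Fin k)) {a b : Fin k} (hab : (b : ℕ) = a + 1) (ha : r ≤ (a : ℕ)) :
    ∑ σ ∈ tailPerms k r, permTrace q m M (σ * z * Equiv.swap a b) =
      ∑ σ ∈ tailPerms k r, permTrace q m M (σ * z) := by
  have hs : Equiv.swap a b ∈ tailPerms k r := swap_mem_tailPerms ha (by omega)
  have h := Finset.sum_congr (rfl : tailPerms k r = tailPerms k r) fun σ _ =>
    permTrace_mul_swap q hq m M (σ * z) a b hab hM
  rw [Finset.sum_add_distrib, Finset.sum_add_distrib] at h
  have h1 := sum_tailPerms_mul_left hs fun σ => permTrace q m M (σ * z)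
  have h2 := sum_tailPerms_mul_left hs fun σ => permTrace q m M (σ * z * Equiv.swap a b)
  simp only [mul_assoc] at h h1 h2 ⊢
  rw [h1, h2, ← two_smul ℂ, ← two_smul ℂ] at h
  exact (smul_right_injective B (two_ne_zero : (2 : ℂ) ≠ 0) h).symm

lemma sum_tailPerms_permTrace_swap_mul_initialCycle (hq : q ≠ 0) (hM : IsManin2 q m M)
    {k r : ℕ} (j : ℕ) (hrj : r + 1 ≤ j) (hj : j < k) :
    ∑ κ ∈ tailPerms k (r + 1),
        permTrace q m M (κ * Equiv.swap ⟨r, by omega⟩ ⟨j, hj⟩ * initialCycle r) =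
      ∑ κ ∈ tailPerms k (r + 1), permTrace q m M (κ * initialCycle (r + 1)) := by
  induction j, hrj using Nat.le_induction with
  | base => simp only [initialCycle, dif_pos hj, mul_assoc]
  | succ j hrj ih =>
    rw [← ih (by omega)]
    set u : Fin k := ⟨r, by omega⟩ with hu
    set a : Fin k := ⟨j, by omega⟩ with ha
    set b : Fin k := ⟨j + 1, hj⟩ with hb
    have hconj : Equiv.swap u b = Equiv.swap a b * Equiv.swap u a * Equiv.swap a b := by
      have hua : u ≠ a := by simp only [ha, hu, ne_eq, Fin.mk.injEq]; omega
      have hub : u ≠ b := by simp only [hb, hu, ne_eq, Fin.mk.injEq]; omega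
      rw [Equiv.swap_mul_swap_mul_swap hua hub, Equiv.swap_comm]
    have hcomm : Equiv.swap a b * initialCycle r = initialCycle r * Equiv.swap a b :=
      swap_mul_initialCycle_comm (by omega) hrj (Nat.lt_succ_of_lt hrj)
    have hs : Equiv.swap a b ∈ tailPerms k (r + 1) :=
      swap_mem_tailPerms hrj (Nat.le_succ_of_le hrj)
    calc _ = ∑ κ ∈ tailPerms k (r + 1),
          permTrace q m M (κ * Equiv.swap a b * (Equiv.swap u a * initialCycle r) *
            Equiv.swap a b) := by
          simp only [hconj, mul_assoc, hcomm]
      _ = ∑ κ ∈ tailPerms k (r + 1),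
          permTrace q m M (κ * (Equiv.swap u a * initialCycle r) * Equiv.swap a b) :=
          sum_tailPerms_mul_right hs fun κ =>
            permTrace q m M (κ * (Equiv.swap u a * initialCycle r) * Equiv.swap a b)
      _ = _ := by
          rw [sum_tailPerms_permTrace_mul_swap hq hM _ rfl hrj]
          simp only [mul_assoc]

lemma sum_tailPerms_permTrace_succ (hq : q ≠ 0) (hM : IsManin2 q m M) {k r : ℕ} (hr : r < k) :
    ∑ σ ∈ tailPerms k r, permTrace q m M (σ * initialCycle r) =
      ∑ σ ∈ tailPerms k (r + 1), permTrace q m M (σ * initialCycle r) +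
        (k - 1 - r) • ∑ σ ∈ tailPerms k (r + 1), permTrace q m M (σ * initialCycle (r + 1)) := by
  rw [sum_tailPerms_eq hr]
  have hsplit : Finset.univ.filter (fun j : Fin k => r ≤ (j : ℕ)) =
      insert ⟨r, hr⟩ (Finset.Ioi (⟨r, hr⟩ : Fin k)) := by
    ext j
    simp only [Finset.mem_filter, Finset.mem_univ, true_and, Finset.mem_insert, Finset.mem_Ioi,
      Fin.lt_def, Fin.ext_iff]
    omega
  rw [hsplit, Finset.sum_insert (by simp), Equiv.swap_self]
  congr 1
  rw [← Fin.card_Ioi ⟨r, hr⟩, ← Finset.sum_const]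
  exact Finset.sum_congr rfl fun j hj =>
    sum_tailPerms_permTrace_swap_mul_initialCycle hq hM (j : ℕ) (Finset.mem_Ioi.mp hj) j.isLt

lemma sum_tailPerms_permTrace_initialCycle (q : ℂ) (m : ℕ) (M : Matrix (Fin N) (Fin N) B)
    (r l : ℕ) :
    ∑ σ ∈ tailPerms (r + 1 + l) (r + 1), permTrace q m M (σ * initialCycle r) =
      l.factorial • (coefT q m M r * coefS q m M l) := by
  rw [sum_tailPerms_eq_sum_blockPerm, initialCycle_eq_blockPerm]
  simp only [blockPerm_mul, permTrace_blockPerm, one_mul, mul_one]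
  rw [← Finset.mul_sum, ← coefT_eq_permTrace, coefS_eq_sum_permTrace, ← mul_smul_comm,
    ← Nat.cast_smul_eq_nsmul ℂ, smul_inv_smul₀ (Nat.cast_ne_zero.mpr l.factorial_ne_zero)]

lemma sum_tailPerms_permTrace (hq : q ≠ 0) (hM : IsManin2 q m M) {k r l : ℕ}
    (hk : k = r + 1 + l) :
    ∑ σ ∈ tailPerms k r, permTrace q m M (σ * initialCycle r) =
      l.factorial • ∑ i ∈ Finset.range (l + 1), coefT q m M (r + i) * coefS q m M (l - i) := by
  have hsub : k - 1 - r = l := by omega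
  rw [sum_tailPerms_permTrace_succ hq hM (by omega), hsub, Finset.sum_range_succ', add_comm,
    smul_add]
  subst hk
  rw [sum_tailPerms_permTrace_initialCycle]
  congr 1
  cases l with
  | zero => simp
  | succ l =>
    rw [sum_tailPerms_permTrace hq hM (by omega : r + 1 + (l + 1) = r + 1 + 1 + l), smul_smul,
      ← Nat.factorial_succ]
    simp only [Nat.add_sub_add_right, add_assoc, add_comm 1]

lemma smul_coefS_succ (hq : q ≠ 0) (hM : IsManin2 q m M) (k : ℕ) :
    ((k + 1 : ℕ) : ℂ) • coefS q m M (k + 1) =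
      ∑ i ∈ Finset.range (k + 1), coefT q m M i * coefS q m M (k - i) := by
  have h := sum_tailPerms_permTrace hq hM (by omega : k + 1 = 0 + 1 + k)
  have hk : (k.factorial : ℂ) ≠ 0 := Nat.cast_ne_zero.mpr k.factorial_ne_zero
  have hk' : ((k + 1 : ℕ) : ℂ) ≠ 0 := Nat.cast_ne_zero.mpr k.succ_ne_zero
  have htail : tailPerms (k + 1) 0 = Finset.univ := by ext; simp [mem_tailPerms]
  simp only [htail, initialCycle, mul_one, zero_add] at h
  rw [coefS_eq_sum_permTrace, h, ← Nat.cast_smul_eq_nsmul ℂ, smul_smul, smul_smul,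
    Nat.factorial_succ, Nat.cast_mul]
  convert one_smul ℂ _
  field_simp

end Manin

/-- Newton's identity, symmetric form: `∂ₜS(t) = T(t)S(t)`. -/
theorem stmt13 (m n : ℕ) (q : ℂ) (hq : q ≠ 0) (A : Type*) [Ring A] [Algebra ℂ A]
    (M : Matrix (Fin (m + n)) (Fin (m + n)) A) (hM : IsManin2 q m M) :
    PowerSeries.mk (fun k => ((k + 1 : ℕ) : ℂ) • coefS q m M (k + 1))
      = PowerSeries.mk (coefT q m M) * PowerSeries.mk (coefS q m M) := by
  ext k
  simp only [PowerSeries.coeff_mul, PowerSeries.coeff_mk]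
  rw [Finset.Nat.sum_antidiagonal_eq_sum_range_succ
    (fun i j => coefT q m M i * coefS q m M j), smul_coefS_succ hq hM]

end QSM
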